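/- Let n ≥ 3 and let nK be the inverse limit continuum determined by the bonding map φ = nφ described in the context. Then nK is atriodic. -/

import Mathlib

/-! ## Simple-n-ods in the plane, likeness, arcs, triods, indecomposability -/

/-- The simple-`n`-od `T_n ⊆ ℂ`: the union of `n` unit segments emanating from `0`. -/
def simpleOdSet (n : ℕ) : Set ℂ :=
  {z | ∃ t : ℝ, ∃ k : ℕ, t ∈ Set.Icc (0:ℝ) 1 ∧ k < n ∧
    z = (t : ℂ) * Complex.exp (2 * Real.pi * Complex.I * (k : ℂ) / (n : ℂ))}

/-- `X` is `Y`-like: for every `ε > 0` there is a continuous surjection `X → Y`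
all of whose point-inverses have diameter `< ε`. -/
def IsLike (X Y : Type*) [MetricSpace X] [MetricSpace Y] : Prop :=
  ∀ ε : ℝ, 0 < ε → ∃ g : X → Y, Continuous g ∧ Function.Surjective g ∧
    ∀ y : Y, Metric.diam (g ⁻¹' {y}) < ε

/-- `A` is an arc: it is homeomorphic to `[0,1]`. -/
def IsArcSet {K : Type*} [TopologicalSpace K] (A : Set K) : Prop :=
  Nonempty (↥A ≃ₜ ↥(Set.Icc (0:ℝ) 1))

/-- Two sets are mutually separated: neither meets the closure of the other. -/
def MutuallySeparated {K : Type*} [TopologicalSpace K] (A B : Set K) : Prop :=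
  A ∩ closure B = ∅ ∧ closure A ∩ B = ∅

/-- The (sub)continuum `C` is a triod: it contains a subcontinuum `M` such that
`C \ M` is the union of three nonempty pairwise mutually separated sets. -/
def IsTriodSet {K : Type*} [TopologicalSpace K] (C : Set K) : Prop :=
  ∃ M A B D : Set K, IsCompact M ∧ IsConnected M ∧ M ⊆ C ∧
    A.Nonempty ∧ B.Nonempty ∧ D.Nonempty ∧ C \ M = A ∪ B ∪ D ∧
    MutuallySeparated A B ∧ MutuallySeparated A D ∧ MutuallySeparated B D

/-- A space is atriodic if it contains no subcontinuum which is a triod. -/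
def AtriodicSpace (K : Type*) [TopologicalSpace K] : Prop :=
  ∀ C : Set K, IsCompact C → IsConnected C → ¬ IsTriodSet C

/-- A space is indecomposable if it is not the union of two proper subcontinua. -/
def IndecomposableSpace (K : Type*) [TopologicalSpace K] : Prop :=
  ¬ ∃ A B : Set K, IsCompact A ∧ IsConnected A ∧ IsCompact B ∧ IsConnected B ∧
    A ≠ Set.univ ∧ B ≠ Set.univ ∧ A ∪ B = Set.univ
/-! ## The simple-`n`-od `S`, the bonding map `φ = nφ`, and the continuum `nK` -/

noncomputable section

/-- Arm-coordinate parametrization of the simple-`n`-od in `ℂ`: the pair `(k, t)`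
is sent to the point at (clamped) parameter `t ∈ [0,1]` on the ray in the
direction `e^{2πik/n}`. -/
def embC (n : ℕ) (p : ℕ × ℝ) : ℂ :=
  ((min 1 (max 0 p.2) : ℝ) : ℂ) * Complex.exp (2 * Real.pi * Complex.I * (p.1 : ℂ) / (n : ℂ))

/-- The underlying simple-`n`-od `S ⊆ ℂ`. -/
def Sset (n : ℕ) : Set ℂ := Set.range (embC n)

/-- The simple-`n`-od `S` as a (compact metric) space. -/
abbrev Sspace (n : ℕ) := ↥(Sset n)

/-- Arm coordinates `(ray index, parameter)` of the vertices `v_0, …, v_{n+2}`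
of the graph `X_0`:  `v_0` is the branch point; for `1 ≤ i ≤ n-2`, `v_i` is the tip
of ray `i - 1`; `v_{n-1}` and `v_{n+1}` are the midpoint and tip of ray `n - 2`;
`v_n` and `v_{n+2}` are the midpoint and tip of ray `n - 1`. -/
def vcoord (n i : ℕ) : ℕ × ℝ :=
  if i = 0 then (0, 0)
  else if i ≤ n - 2 then (i - 1, 1)
  else if i = n - 1 then (n - 2, 1 / 2)
  else if i = n then (n - 1, 1 / 2)
  else if i = n + 1 then (n - 2, 1)
  else (n - 1, 1)

/-- The vertex `v_i` of `X_0` as a point of `S`. -/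
def vpt (n i : ℕ) : Sspace n := ⟨embC n (vcoord n i), Set.mem_range_self _⟩

/-- The branch point `v_0` of `S`. -/
def centerPt (n : ℕ) : Sspace n := vpt n 0

/-- Affine interpolation, in arm coordinates, between two adjacent vertices of
`X_0` (they lie on a common ray; if one of them is the branch point, the ray of
the other one is used). -/
def interpC (w w' : ℕ × ℝ) (s : ℝ) : ℕ × ℝ :=
  (if w.2 = 0 then w'.1 else w.1, (1 - s) * w.2 + s * w'.2)

/-- Arm coordinates of the `φ`-image of the `j`-th vertex of `X_1` (counted from
`v_0` outwards) on the `a`-th arm of `X_1` (`1 ≤ a ≤ n`), following the defining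
table of `φ = nφ`:

* arm `a ≤ n - 3` has vertices `v_0, u_a, u_{(n-3)+a}, …, u_{2(n-1)(n-3)+a}, v_a`;
* arm `n - 2` has vertices `v_0, u_{(2n-1)(n-3)+2(n-1)+1}, v_{n-2}`;
* arm `n - 1` has vertices `v_0, u_{(2n-1)(n-3)+2(n-1)+2}, u_{(2n-1)(n-3)+2(n-1)+3},
  v_{n-1}, v_{n+1}`;
* arm `n` has vertices `v_0, u_{(2n-1)(n-3)+1}, …, u_{(2n-1)(n-3)+2(n-1)}, v_n, v_{n+2}`. -/
def imgCoord (n a j : ℕ) : ℕ × ℝ :=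
  if a = n then
    (if j = 0 then vcoord n 0
     else if j ≤ 2 * n - 2 then
       (if j = 1 then vcoord n (n - 1)
        else if j % 2 = 0 then vcoord n 0
        else if j = 3 then vcoord n (n - 2)
        else vcoord n ((j - 3) / 2))
     else if j = 2 * n - 1 then vcoord n n
     else vcoord n (n + 2))
  else if a = n - 1 then
    (if j = 0 then vcoord n 0
     else if j = 1 then vcoord n (n - 1)
     else if j = 2 then vcoord n 0
     else if j = 3 then vcoord n n
     else vcoord n (n + 2))
  else if a = n - 2 then
    (if j = 0 then vcoord n 0
     else if j = 1 then vcoord n (n - 1)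
     else vcoord n (n + 1))
  else
    (if j = 0 then vcoord n 0
     else if j ≤ 2 * n - 1 then
       (if j = 1 then vcoord n (n - 1)
        else if j = 2 * n - 1 then vcoord n n
        else if (j - 1) % 2 = 1 then vcoord n 0
        else vcoord n ((a + (j - 1) / 2 - 2) % (n - 2) + 1))
     else vcoord n (n + 2))

/-- Locating a parameter `t ∈ [0,1]` on arm `a` of the subdivision `X_1`:
returns the index `j` of the edge of `X_1` containing the point together with the
affine coordinate `s ∈ [0,1]` inside this edge.  The vertices of `X_1` are placed
at: `j/(2n)` (`0 ≤ j ≤ 2n`) on arms `a ≤ n-3`; at `0, 1/2, 1` on arm `n-2`;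
at `0, 1/6, 2/6, 3/6, 1` on arm `n-1` (the vertices `v_{n-1}`, `v_{n+1}` sit at
`1/2` and `1`); and at `j/(4n-2)` (`0 ≤ j ≤ 2n-1`) followed by `1` on arm `n`
(the vertices `v_n`, `v_{n+2}` sit at `1/2` and `1`). -/
def segOf (n a : ℕ) (t : ℝ) : ℕ × ℝ :=
  if a = n then
    (if t ≤ 1 / 2 then
      (min (2 * n - 2) ⌊(4 * (n : ℝ) - 2) * t⌋₊,
        (4 * (n : ℝ) - 2) * t - (min (2 * n - 2) ⌊(4 * (n : ℝ) - 2) * t⌋₊ : ℕ))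
     else (2 * n - 1, 2 * t - 1))
  else if a = n - 1 then
    (if t ≤ 1 / 2 then
      (min 2 ⌊6 * t⌋₊, 6 * t - (min 2 ⌊6 * t⌋₊ : ℕ))
     else (3, 2 * t - 1))
  else if a = n - 2 then
    (min 1 ⌊2 * t⌋₊, 2 * t - (min 1 ⌊2 * t⌋₊ : ℕ))
  else
    (min (2 * n - 1) ⌊2 * (n : ℝ) * t⌋₊,
      2 * (n : ℝ) * t - (min (2 * n - 1) ⌊2 * (n : ℝ) * t⌋₊ : ℕ))

/-- The bonding map `φ` in arm coordinates: a point with arm coordinates `p` lies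
on arm `a = p.1 % n + 1` at parameter `t`; it lies in the `j`-th edge of `X_1`
on this arm with affine coordinate `s`, and is mapped to the corresponding affine
combination of the `φ`-images of the endpoints of this edge. -/
def Gmap (n : ℕ) (p : ℕ × ℝ) : ℕ × ℝ :=
  interpC (imgCoord n (p.1 % n + 1) (segOf n (p.1 % n + 1) (min 1 (max 0 p.2))).1)
    (imgCoord n (p.1 % n + 1) ((segOf n (p.1 % n + 1) (min 1 (max 0 p.2))).1 + 1))
    (segOf n (p.1 % n + 1) (min 1 (max 0 p.2))).2

/-- The piecewise-linear bonding map `f : S → S` induced by `φ`. -/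
def fS (n : ℕ) : Sspace n → Sspace n := fun z =>
  ⟨embC n (Gmap n (Function.invFun (embC n) (z : ℂ))), Set.mem_range_self _⟩

/-- The continuum `nK`: the inverse limit of the sequence `S ←f S ←f S ⋯`,
realized inside the countable product `S^ℕ`. -/
abbrev nK (n : ℕ) := {x : ℕ → Sspace n // ∀ k, fS n (x (k + 1)) = x k}

end

/-! ## Separations of connected sets -/

theorem isPreconnected_union_of_separated {K : Type*} [TopologicalSpace K] {C M A R : Set K}
    (hC : IsPreconnected C) (hM : IsPreconnected M) (hMC : M ⊆ C) (h : C \ M = A ∪ R)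
    (hAR : MutuallySeparated A R) : IsPreconnected (M ∪ A) := by
  have hAC : A ⊆ C := fun x hx => (h.symm.subset (Or.inl hx)).1
  have hcov : ∀ x ∈ C, x ∈ M ∨ x ∈ A ∨ x ∈ R := fun x hx => by
    by_cases hxM : x ∈ M
    · exact Or.inl hxM
    · exact Or.inr (h.subset ⟨hx, hxM⟩)
  have hA : ∀ x ∈ A, x ∉ closure R := fun x hx hx' => by
    have : x ∈ A ∩ closure R := ⟨hx, hx'⟩
    simp [hAR.1] at this
  have hR : ∀ x ∈ R, x ∉ closure A := fun x hx hx' => by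
    have : x ∈ closure A ∩ R := ⟨hx', hx⟩
    simp [hAR.2] at this
  have key : ∀ u v : Set K, IsOpen u → IsOpen v → M ∪ A ⊆ u ∪ v → (M ∪ A) ∩ (u ∩ v) = ∅ →
      M ⊆ u → M ∪ A ⊆ u ∨ M ∪ A ⊆ v := by
    intro u v hu hv hsub hdis hMu
    have hnot : ∀ x ∈ M ∪ A, x ∈ u → x ∉ v := fun x hx hxu hxv => by
      have : x ∈ (M ∪ A) ∩ (u ∩ v) := ⟨hx, hxu, hxv⟩
      simp [hdis] at this
    have := isPreconnected_iff_subset_of_disjoint.1 hC (u ∪ (closure A)ᶜ) (v ∩ (closure R)ᶜ)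
      (hu.union isClosed_closure.isOpen_compl) (hv.inter isClosed_closure.isOpen_compl) ?_ ?_
    · rcases this with h1 | h1
      · left
        rintro x (hx | hx)
        · exact hMu hx
        · exact (h1 (hAC hx)).resolve_right (fun h2 => h2 (subset_closure hx))
      · right
        exact fun x hx => (h1 (Set.union_subset hMC hAC hx)).1
    · intro x hx
      rcases hcov x hx with h1 | h1 | h1
      · exact Or.inl (Or.inl (hMu h1))
      · rcases hsub (Or.inr h1) with h2 | h2
        · exact Or.inl (Or.inl h2)
        · exact Or.inr ⟨h2, hA x h1⟩
      · exact Or.inl (Or.inr (hR x h1))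
    · rw [Set.eq_empty_iff_forall_notMem]
      rintro x ⟨hx, hxu, hxv, hxR⟩
      have hxR' : x ∉ R := fun h2 => hxR (subset_closure h2)
      rcases hcov x hx with h1 | h1 | h1
      · exact hnot x (Or.inl h1) (hMu h1) hxv
      · rcases hxu with h2 | h2
        · exact hnot x (Or.inr h1) h2 hxv
        · exact h2 (subset_closure h1)
      · exact hxR' h1
  rw [isPreconnected_iff_subset_of_disjoint]
  intro u v hu hv hsub hdis
  rcases isPreconnected_iff_subset_of_disjoint.1 hM u v hu hv
      (Set.subset_union_left.trans hsub)
      (Set.subset_empty_iff.1 (hdis ▸ Set.inter_subset_inter_left _ Set.subset_union_left))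
    with h1 | h1
  · exact key u v hu hv hsub hdis h1
  · exact (key v u hv hu (by rwa [Set.union_comm v u]) (by rwa [Set.inter_comm v u]) h1).symm

theorem isCompact_union_of_separated {K : Type*} [TopologicalSpace K] [T2Space K]
    {C M A R : Set K} (hC : IsCompact C) (hM : IsCompact M) (hMC : M ⊆ C)
    (h : C \ M = A ∪ R) (hAR : MutuallySeparated A R) : IsCompact (M ∪ R) := by
  have hRC : R ⊆ C := fun x hx => (h.symm.subset (Or.inr hx)).1
  refine hC.of_isClosed_subset ?_ (Set.union_subset hMC hRC)
  refine isClosed_of_closure_subset ?_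
  rw [closure_union, hM.isClosed.closure_eq]
  rintro x (hx | hx)
  · exact Or.inl hx
  · by_cases hxM : x ∈ M
    · exact Or.inl hxM
    · rcases h.subset ⟨closure_minimal hRC hC.isClosed hx, hxM⟩ with h1 | h1
      · have : x ∈ A ∩ closure R := ⟨h1, hx⟩
        simp [hAR.1] at this
      · exact Or.inr h1

theorem MutuallySeparated.symm {K : Type*} [TopologicalSpace K] {A B : Set K}
    (h : MutuallySeparated A B) : MutuallySeparated B A :=
  ⟨by rw [Set.inter_comm]; exact h.2, by rw [Set.inter_comm]; exact h.1⟩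

theorem MutuallySeparated.union_right {K : Type*} [TopologicalSpace K] {A B D : Set K}
    (hB : MutuallySeparated A B) (hD : MutuallySeparated A D) : MutuallySeparated A (B ∪ D) :=
  ⟨by rw [closure_union, Set.inter_union_distrib_left, hB.1, hD.1, Set.union_empty],
    by rw [Set.inter_union_distrib_left, hB.2, hD.2, Set.union_empty]⟩

/-! ## Points of an inverse limit -/

/-- In an inverse limit, a point outside a compact set is eventually separated from it by the
coordinate projections. -/
theorem exists_forall_coord_notMem_image {X : Type*} [TopologicalSpace X] [T2Space X]
    {f : X → X} {K : Set {x : ℕ → X // ∀ k, f (x (k + 1)) = x k}} (hK : IsCompact K)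
    {z : {x : ℕ → X // ∀ k, f (x (k + 1)) = x k}} (hz : z ∉ K) :
    ∃ N, ∀ k, N ≤ k → ∀ w ∈ K, w.1 k ≠ z.1 k := by
  have hcont : ∀ k, Continuous fun w : {x : ℕ → X // ∀ k, f (x (k + 1)) = x k} => w.1 k :=
    fun k => (continuous_apply k).comp continuous_subtype_val
  have hstep : ∀ (w : {x : ℕ → X // ∀ k, f (x (k + 1)) = x k}) (k : ℕ),
      w.1 (k + 1) = z.1 (k + 1) → w.1 k = z.1 k := fun w k h => by
    rw [← w.2 k, ← z.2 k, h]
  have hanti : Antitone fun k => {w : {x : ℕ → X // ∀ k, f (x (k + 1)) = x k} | w.1 k = z.1 k} :=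
    antitone_nat_of_succ_le fun k w hw => hstep w k hw
  obtain ⟨N, hN⟩ := hK.elim_directed_family_closed
    (fun k => {w : {x : ℕ → X // ∀ k, f (x (k + 1)) = x k} | w.1 k = z.1 k})
    (fun k => isClosed_eq (hcont k) continuous_const)
    (by
      rw [Set.eq_empty_iff_forall_notMem]
      rintro w ⟨hw, hw'⟩
      rw [Set.mem_iInter] at hw'
      exact hz ((Subtype.ext (funext hw') : w = z) ▸ hw))
    hanti.directed_ge
  refine ⟨N, fun k hk w hw h => ?_⟩
  have : w ∈ K ∩ {w : {x : ℕ → X // ∀ k, f (x (k + 1)) = x k} | w.1 N = z.1 N} :=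
    ⟨hw, hanti hk h⟩
  simp [hN] at this

/-! ## Connected sets in a simple-`n`-od -/

/-- Along a function that is injective on its nonnegative part, three connected sets with a common
point, each having a point outside of the others, have at most one such point on the nonnegative
part. -/
theorem eq_of_nonneg_of_forall_notMem {X ι : Type*} [TopologicalSpace X] {σ : X → ℝ}
    (hσ : Continuous σ) (hinj : ∀ a b, 0 ≤ σ a → σ a = σ b → a = b) {T : ι → Set X}
    (hT : ∀ i, IsPreconnected (T i)) {p : X} (hp : ∀ i, p ∈ T i) {x : ι → X}
    (hx : ∀ i, x i ∈ T i) (hxT : ∀ i j, i ≠ j → x i ∉ T j)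
    (hthird : ∀ i j : ι, ∃ l, l ≠ i ∧ l ≠ j) {i j : ι}
    (hi : 0 ≤ σ (x i)) (hj : 0 ≤ σ (x j)) : i = j := by
  have ivt : ∀ (l : ι) (a b c : X), a ∈ T l → b ∈ T l → 0 ≤ σ c → σ a ≤ σ c → σ c ≤ σ b →
      c ∈ T l := by
    intro l a b c ha hb hc hac hcb
    obtain ⟨d, hd, hdc⟩ := (hT l).intermediate_value ha hb hσ.continuousOn ⟨hac, hcb⟩
    rwa [hinj c d hc hdc.symm]
  by_contra hij
  wlog hle : σ (x i) ≤ σ (x j) generalizing i j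
  · exact this hj hi (Ne.symm hij) (le_of_not_ge hle)
  have h1 : σ (x i) < σ p := by
    by_contra! h
    exact hxT i j hij (ivt j p (x j) (x i) (hp j) (hx j) hi h hle)
  have h2 : σ p < σ (x j) := by
    by_contra! h
    exact hxT j i (Ne.symm hij) (ivt i (x i) p (x j) (hx i) (hp i) hj hle h)
  obtain ⟨l, hli, hlj⟩ := hthird i j
  rcases le_total (σ (x l)) (σ (x i)) with h3 | h3
  · exact hxT i l (Ne.symm hli) (ivt l (x l) p (x i) (hx l) (hp l) hi h3 h1.le)
  rcases le_total (σ (x j)) (σ (x l)) with h4 | h4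
  · exact hxT j l (Ne.symm hlj) (ivt l p (x l) (x j) (hp l) (hx l) hj h2.le h4)
  rcases le_total (σ (x l)) (σ p) with h5 | h5
  · exact hxT l i hli (ivt i (x i) p (x l) (hx i) (hp i) (hi.trans h3) h3 h5)
  · exact hxT l j hlj (ivt j p (x j) (x l) (hp j) (hx j) (hi.trans h3) h5 h4)

noncomputable section

/-- The point of the simple-`n`-od with arm coordinates `(r, t)`. -/
def armPt (n r : ℕ) (t : ℝ) : Sspace n := ⟨embC n (r, t), Set.mem_range_self _⟩

/-- The direction of the `r`-th ray. -/
def rayDir (n r : ℕ) : ℂ := Complex.exp (2 * Real.pi * Complex.I * (r : ℂ) / (n : ℂ))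

/-- Signed distance to the branch point, nonnegative exactly on the `r`-th ray. -/
def rayCoord (n r : ℕ) (z : Sspace n) : ℝ :=
  ‖(z : ℂ)‖ - (∑ s ∈ Finset.range n, 2 / ‖rayDir n s - rayDir n r‖) *
    ‖(z : ℂ) - (‖(z : ℂ)‖ : ℂ) * rayDir n r‖

end

theorem continuous_rayCoord (n r : ℕ) : Continuous (rayCoord n r) := by
  unfold rayCoord
  fun_prop

theorem norm_rayDir (n r : ℕ) : ‖rayDir n r‖ = 1 := by
  have : (2 * Real.pi * Complex.I * (r : ℂ) / (n : ℂ)) =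
      ((2 * Real.pi * r / n : ℝ) : ℂ) * Complex.I := by
    push_cast
    ring
  rw [rayDir, this, Complex.norm_exp_ofReal_mul_I]

theorem rayDir_eq_pow (n r : ℕ) : rayDir n r = Complex.exp (2 * Real.pi * Complex.I / n) ^ r := by
  rw [rayDir, ← Complex.exp_nat_mul]
  congr 1
  ring

theorem rayDir_mod {n : ℕ} (hn : n ≠ 0) (r : ℕ) : rayDir n (r % n) = rayDir n r := by
  rw [rayDir_eq_pow, rayDir_eq_pow]
  exact (pow_eq_pow_mod r (Complex.isPrimitiveRoot_exp n hn).pow_eq_one).symm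

theorem rayDir_injOn {n : ℕ} (hn : n ≠ 0) {r s : ℕ} (hr : r < n) (hs : s < n)
    (h : rayDir n r = rayDir n s) : r = s := by
  rw [rayDir_eq_pow, rayDir_eq_pow] at h
  exact (Complex.isPrimitiveRoot_exp n hn).pow_inj hr hs h

theorem embC_eq (n : ℕ) (p : ℕ × ℝ) :
    embC n p = ((min 1 (max 0 p.2) : ℝ) : ℂ) * rayDir n p.1 := rfl

theorem coe_armPt {n r : ℕ} {t : ℝ} (h0 : 0 ≤ t) (h1 : t ≤ 1) :
    (armPt n r t : ℂ) = t * rayDir n r := by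
  change embC n (r, t) = _
  rw [embC_eq, max_eq_right h0, min_eq_right h1]

theorem norm_armPt {n r : ℕ} {t : ℝ} (h0 : 0 ≤ t) (h1 : t ≤ 1) : ‖(armPt n r t : ℂ)‖ = t := by
  rw [coe_armPt h0 h1, norm_mul, norm_rayDir, mul_one, Complex.norm_real, Real.norm_of_nonneg h0]

theorem armPt_zero (n r s : ℕ) : armPt n r 0 = armPt n s 0 := by
  apply Subtype.ext
  rw [coe_armPt le_rfl zero_le_one, coe_armPt le_rfl zero_le_one]
  simp

theorem exists_eq_armPt {n : ℕ} (hn : n ≠ 0) (z : Sspace n) :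
    ∃ r t, r < n ∧ 0 ≤ t ∧ t ≤ 1 ∧ z = armPt n r t := by
  obtain ⟨z, p, rfl⟩ := z
  refine ⟨p.1 % n, min 1 (max 0 p.2), Nat.mod_lt _ (Nat.pos_of_ne_zero hn),
    le_min zero_le_one (le_max_left _ _), min_le_left _ _, Subtype.ext ?_⟩
  rw [coe_armPt (le_min zero_le_one (le_max_left _ _)) (min_le_left _ _), rayDir_mod hn]
  rfl

theorem rayCoord_armPt_self {n r : ℕ} {t : ℝ} (h0 : 0 ≤ t) (h1 : t ≤ 1) :
    rayCoord n r (armPt n r t) = t := by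
  rw [rayCoord, norm_armPt h0 h1, coe_armPt h0 h1, sub_self, norm_zero, mul_zero, sub_zero]

theorem rayCoord_armPt_neg {n r s : ℕ} (hn : n ≠ 0) (hr : r < n) (hs : s < n) (hrs : s ≠ r)
    {t : ℝ} (h0 : 0 < t) (h1 : t ≤ 1) : rayCoord n r (armPt n s t) < 0 := by
  have hpos : 0 < ‖rayDir n s - rayDir n r‖ :=
    norm_pos_iff.2 (sub_ne_zero.2 fun h => hrs (rayDir_injOn hn hs hr h))
  have hle : 2 / ‖rayDir n s - rayDir n r‖ ≤
      ∑ s ∈ Finset.range n, 2 / ‖rayDir n s - rayDir n r‖ :=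
    Finset.single_le_sum (f := fun s => 2 / ‖rayDir n s - rayDir n r‖)
      (fun i _ => by positivity) (Finset.mem_range.2 hs)
  rw [rayCoord, norm_armPt h0.le h1, coe_armPt h0.le h1, ← mul_sub, norm_mul,
    Complex.norm_real, Real.norm_of_nonneg h0.le]
  have := mul_le_mul_of_nonneg_right hle (mul_pos h0 hpos).le
  have h2 : 2 / ‖rayDir n s - rayDir n r‖ * (t * ‖rayDir n s - rayDir n r‖) = 2 * t := by
    field_simp
  linarith

theorem eq_armPt_of_rayCoord_nonneg {n r : ℕ} (hn : n ≠ 0) (hr : r < n) {z : Sspace n}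
    (hz : 0 ≤ rayCoord n r z) : z = armPt n r (rayCoord n r z) := by
  obtain ⟨s, t, hs, h0, h1, rfl⟩ := exists_eq_armPt hn z
  rcases eq_or_ne s r with rfl | hsr
  · rw [rayCoord_armPt_self h0 h1]
  · rcases h0.eq_or_lt with rfl | h0
    · rw [armPt_zero n s r, rayCoord_armPt_self le_rfl zero_le_one]
    · exact absurd (rayCoord_armPt_neg hn hr hs hsr h0 h1) (not_lt.2 hz)

theorem rayCoord_injective_of_nonneg {n r : ℕ} (hn : n ≠ 0) (hr : r < n) (a b : Sspace n)
    (ha : 0 ≤ rayCoord n r a) (hab : rayCoord n r a = rayCoord n r b) : a = b := by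
  calc a = armPt n r (rayCoord n r a) := eq_armPt_of_rayCoord_nonneg hn hr ha
    _ = armPt n r (rayCoord n r b) := by rw [hab]
    _ = b := (eq_armPt_of_rayCoord_nonneg hn hr (hab ▸ ha)).symm

/-- A connected set containing the branch point is star-shaped. -/
theorem armPt_mem_of_isPreconnected {n r : ℕ} (hn : n ≠ 0) (hr : r < n) {T : Set (Sspace n)}
    (hT : IsPreconnected T) (h0 : armPt n 0 0 ∈ T) {s t : ℝ} (hs : 0 ≤ s) (hst : s ≤ t)
    (ht : t ≤ 1) (hmem : armPt n r t ∈ T) : armPt n r s ∈ T := by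
  rw [armPt_zero n 0 r] at h0
  obtain ⟨d, hd, hds⟩ := hT.intermediate_value h0 hmem (continuous_rayCoord n r).continuousOn
    (show s ∈ Set.Icc _ _ by
      rw [rayCoord_armPt_self le_rfl zero_le_one, rayCoord_armPt_self (hs.trans hst) ht]
      exact ⟨hs, hst⟩)
  rwa [← hds, ← eq_armPt_of_rayCoord_nonneg hn hr (hds ▸ hs)]

/-- A connected set missing the branch point lies on a single ray. -/
theorem rayCoord_nonneg_of_zero_notMem {n r : ℕ} (hn : n ≠ 0) (hr : r < n) {T : Set (Sspace n)}
    (hT : IsPreconnected T) (h0 : armPt n 0 0 ∉ T) {p z : Sspace n} (hp : p ∈ T) (hz : z ∈ T)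
    (hpos : 0 ≤ rayCoord n r p) : 0 ≤ rayCoord n r z := by
  by_contra! h
  obtain ⟨d, hd, hds⟩ := hT.intermediate_value hz hp (continuous_rayCoord n r).continuousOn
    ⟨h.le, hpos⟩
  rw [eq_armPt_of_rayCoord_nonneg hn hr hds.ge, hds, armPt_zero n r 0] at hd
  exact h0 hd

/-! ## The bonding map -/

theorem imgCoord_zero (n a : ℕ) : imgCoord n a 0 = (0, 0) := by
  simp [imgCoord, vcoord]

theorem imgCoord_one {n : ℕ} (hn : 3 ≤ n) (a : ℕ) : imgCoord n a 1 = (n - 2, 1 / 2) := by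
  have h : vcoord n (n - 1) = (n - 2, 1 / 2) := by
    rw [vcoord, if_neg (by omega), if_neg (by omega), if_pos rfl]
  have h1 : 1 ≤ 2 * n - 2 := by omega
  have h2 : 1 ≤ 2 * n - 1 := by omega
  simp [imgCoord, h, h1, h2]

theorem segOf_zero (n a : ℕ) : segOf n a 0 = (0, 0) := by
  simp [segOf]

theorem interpC_zero {w : ℕ × ℝ} (w' : ℕ × ℝ) (hw : w.2 ≠ 0) : interpC w w' 0 = w := by
  simp [interpC, hw]

theorem interpC_one {w : ℕ × ℝ} (w' : ℕ × ℝ) (hw : w.2 = 0) : interpC w w' 1 = w' := by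
  simp [interpC, hw]

theorem fS_armPt {n r : ℕ} (hr : r < n) {t : ℝ} (h0 : 0 ≤ t) (h1 : t ≤ 1) {j : ℕ} {s : ℝ}
    (hseg : segOf n (r + 1) t = (j, s)) :
    fS n (armPt n r t) =
      armPt n (interpC (imgCoord n (r + 1) j) (imgCoord n (r + 1) (j + 1)) s).1
        (interpC (imgCoord n (r + 1) j) (imgCoord n (r + 1) (j + 1)) s).2 := by
  have hn : n ≠ 0 := by omega
  apply Subtype.ext
  change embC n (Gmap n (Function.invFun (embC n) (embC n (r, t)))) = embC n (interpC _ _ s)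
  have hp : embC n (Function.invFun (embC n) (embC n (r, t))) = embC n (r, t) :=
    Function.invFun_eq ⟨_, rfl⟩
  generalize Function.invFun (embC n) (embC n (r, t)) = p at hp
  rw [embC_eq, embC_eq, max_eq_right h0, min_eq_right h1] at hp
  have ht : min 1 (max 0 p.2) = t := by
    have := congrArg norm hp
    rwa [norm_mul, norm_mul, norm_rayDir, norm_rayDir, mul_one, mul_one, Complex.norm_real,
      Complex.norm_real, Real.norm_of_nonneg h0,
      Real.norm_of_nonneg (le_min zero_le_one (le_max_left _ _))] at this
  rcases h0.eq_or_lt with rfl | h0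
  · rw [segOf_zero, Prod.mk.injEq] at hseg
    obtain ⟨rfl, rfl⟩ := hseg
    rw [Gmap, ht, segOf_zero, embC_eq, embC_eq]
    simp [interpC, imgCoord_zero]
  · rw [ht] at hp
    have hdir := mul_left_cancel₀ (Complex.ofReal_ne_zero.2 h0.ne') hp
    rw [← rayDir_mod hn] at hdir
    have hpr : p.1 % n = r := rayDir_injOn hn (Nat.mod_lt _ (Nat.pos_of_ne_zero hn)) hr hdir
    rw [Gmap, ht, hpr, hseg]

theorem fS_zero {n : ℕ} (hn : n ≠ 0) : fS n (armPt n 0 0) = armPt n 0 0 := by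
  rw [fS_armPt (Nat.pos_of_ne_zero hn) le_rfl zero_le_one (segOf_zero n _), imgCoord_zero]
  simpa [interpC] using armPt_zero n _ 0

/-- Every arm of the subdivided simple-`n`-od has a first edge. -/
theorem exists_segOf_first {n r : ℕ} (hn : 3 ≤ n) :
    ∃ c : ℝ, 2 ≤ c ∧ segOf n (r + 1) (1 / c) = (1, 0) ∧
      ∀ t, 0 ≤ t → t < 1 / c → segOf n (r + 1) t = (0, c * t) := by
  have hn' : (3 : ℝ) ≤ n := by exact_mod_cast hn
  have hfl : ∀ c : ℝ, 2 ≤ c → ∀ t, t < 1 / c → ⌊c * t⌋₊ = 0 := fun c hc t ht => by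
    rw [Nat.floor_eq_zero]
    rwa [lt_div_iff₀ (by linarith), mul_comm] at ht
  have hhalf : ∀ c : ℝ, 2 ≤ c → 1 / c ≤ 1 / 2 := fun c hc =>
    one_div_le_one_div_of_le two_pos hc
  by_cases h1 : r + 1 = n
  · have hc : 2 ≤ 4 * (n : ℝ) - 2 := by linarith
    refine ⟨4 * n - 2, hc, ?_, fun t h0 ht => ?_⟩
    · have : 1 ≤ 2 * n - 2 := by omega
      rw [segOf, if_pos h1, if_pos (hhalf _ hc), mul_one_div_cancel (by linarith)]
      simp [this]
    · rw [segOf, if_pos h1, if_pos (ht.le.trans (hhalf _ hc)), hfl _ hc t ht]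
      simp
  by_cases h2 : r + 1 = n - 1
  · refine ⟨6, by norm_num, ?_, fun t h0 ht => ?_⟩
    · rw [segOf, if_neg h1, if_pos h2, if_pos (by norm_num)]
      norm_num
    · rw [segOf, if_neg h1, if_pos h2, if_pos (ht.le.trans (by norm_num)),
        hfl _ (by norm_num) t ht]
      simp
  by_cases h3 : r + 1 = n - 2
  · refine ⟨2, le_rfl, ?_, fun t h0 ht => ?_⟩
    · rw [segOf, if_neg h1, if_neg h2, if_pos h3]
      norm_num
    · rw [segOf, if_neg h1, if_neg h2, if_pos h3, hfl _ le_rfl t ht]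
      simp
  · have hc : 2 ≤ 2 * (n : ℝ) := by linarith
    refine ⟨2 * n, hc, ?_, fun t h0 ht => ?_⟩
    · have : 1 ≤ 2 * n - 1 := by omega
      rw [segOf, if_neg h1, if_neg h2, if_neg h3, mul_one_div_cancel (by linarith)]
      simp [this]
    · rw [segOf, if_neg h1, if_neg h2, if_neg h3, hfl _ hc t ht]
      simp

/-- Every arm starts by running along the inner half of the `(n - 1)`-st arm. -/
theorem exists_fS_armPt_eq_mid {n r : ℕ} (hn : 3 ≤ n) (hr : r < n) :
    ∃ τ : ℝ, 0 ≤ τ ∧ τ ≤ 1 / 2 ∧ fS n (armPt n r τ) = armPt n (n - 2) (1 / 2) ∧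
      ∀ t, 0 ≤ t → t ≤ τ → ∃ u, 0 ≤ u ∧ u ≤ 1 / 2 ∧ fS n (armPt n r t) = armPt n (n - 2) u := by
  obtain ⟨c, hc, hc1, hc0⟩ := exists_segOf_first (r := r) hn
  have hc2 : 1 / c ≤ 1 / 2 := one_div_le_one_div_of_le two_pos hc
  have hτ0 : 0 ≤ 1 / c := by positivity
  have hτ : fS n (armPt n r (1 / c)) = armPt n (n - 2) (1 / 2) := by
    rw [fS_armPt hr hτ0 (by linarith) hc1, imgCoord_one hn, interpC_zero _ (by norm_num)]
  refine ⟨1 / c, hτ0, hc2, hτ, fun t h0 ht => ?_⟩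
  rcases ht.lt_or_eq with ht | rfl
  · refine ⟨c * t * (1 / 2), by positivity, ?_, ?_⟩
    · rw [lt_div_iff₀ (by linarith)] at ht
      linarith
    · rw [fS_armPt hr h0 (by linarith) (hc0 t h0 ht), imgCoord_zero, imgCoord_one hn]
      simp [interpC]
  · exact ⟨1 / 2, by norm_num, le_rfl, hτ⟩

theorem fS_mid {n : ℕ} (hn : 3 ≤ n) :
    fS n (armPt n (n - 2) (1 / 2)) = armPt n (n - 1) (1 / 2) := by
  have ha : n - 2 + 1 = n - 1 := by omega
  have hseg : segOf n (n - 2 + 1) (1 / 2) = (2, 1) := by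
    rw [ha, segOf, if_neg (by omega), if_pos rfl, if_pos le_rfl]
    norm_num
  rw [fS_armPt (by omega) (by norm_num) (by norm_num) hseg, ha]
  have h2 : imgCoord n (n - 1) 2 = (0, 0) := by
    rw [imgCoord, if_neg (by omega), if_pos rfl]
    simp [vcoord]
  have h3 : imgCoord n (n - 1) (2 + 1) = (n - 1, 1 / 2) := by
    rw [imgCoord, if_neg (by omega), if_pos rfl, if_neg (by omega), if_neg (by omega),
      if_neg (by omega),
      if_pos rfl, vcoord, if_neg (by omega), if_neg (by omega), if_neg (by omega), if_pos rfl]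
  rw [h2, h3, interpC_one _ rfl]

/-- The inner half of the last arm runs over all of the first `n - 2` arms. -/
theorem exists_fS_armPt_eq_tip {n i : ℕ} (hn : 3 ≤ n) (hi : i < n - 2) :
    ∃ t : ℝ, 0 ≤ t ∧ t ≤ 1 / 2 ∧ fS n (armPt n (n - 1) t) = armPt n i 1 := by
  have hn' : (3 : ℝ) ≤ n := by exact_mod_cast hn
  have ha : n - 1 + 1 = n := by omega
  obtain ⟨j, hj, himg⟩ : ∃ j, j ≤ 2 * n - 3 ∧ imgCoord n n j = (i, 1) := by
    by_cases h : i = n - 3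
    · refine ⟨3, by omega, ?_⟩
      rw [imgCoord, if_pos rfl, if_neg (by omega), if_pos (by omega), if_neg (by omega),
        if_neg (by omega), if_pos rfl, vcoord, if_neg (by omega), if_pos le_rfl, h]
      simp only [Nat.sub_sub]
    · refine ⟨2 * i + 5, by omega, ?_⟩
      have h5 : (2 * i + 5 - 3) / 2 = i + 1 := by omega
      rw [imgCoord, if_pos rfl, if_neg (by omega), if_pos (by omega), if_neg (by omega),
        if_neg (by omega), if_neg (by omega), h5, vcoord, if_neg (by omega), if_pos (by omega),
        Nat.add_sub_cancel]
  have hc : 0 < 4 * (n : ℝ) - 2 := by linarith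
  have hj' : (j : ℝ) ≤ 2 * n - 3 := by
    have : j + 3 ≤ 2 * n := by omega
    have : (j : ℝ) + 3 ≤ 2 * n := by exact_mod_cast this
    linarith
  have ht : (j : ℝ) / (4 * n - 2) ≤ 1 / 2 := by
    rw [div_le_iff₀ hc]
    linarith
  have ht0 : 0 ≤ (j : ℝ) / (4 * n - 2) := by positivity
  have hseg : segOf n (n - 1 + 1) (j / (4 * n - 2)) = (j, 0) := by
    rw [ha, segOf, if_pos rfl, if_pos ht, mul_div_cancel₀ _ hc.ne', Nat.floor_natCast,
      min_eq_right (by omega), sub_self]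
  refine ⟨j / (4 * n - 2), ht0, ht, ?_⟩
  rw [fS_armPt (by omega) ht0 (by linarith) hseg, ha, himg, interpC_zero _ one_ne_zero]

/-! ## Three connected sets spreading from a common point -/

/-- Three connected sets with a common point such that the `i`-th contains the point `x i`, which
lies in none of the others. -/
structure IsWeakTriod {X : Type*} [TopologicalSpace X] (T : Fin 3 → Set X) (x : Fin 3 → X) :
    Prop where
  isPreconnected : ∀ i, IsPreconnected (T i)
  exists_common : ∃ p, ∀ i, p ∈ T i
  mem : ∀ i, x i ∈ T i
  notMem : ∀ i j, i ≠ j → x i ∉ T j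

namespace IsWeakTriod

variable {n : ℕ} {T : Fin 3 → Set (Sspace n)} {x : Fin 3 → Sspace n}

theorem eq_of_rayCoord_nonneg (h : IsWeakTriod T x) (hn : n ≠ 0) {r : ℕ} (hr : r < n) {i j : Fin 3}
    (hi : 0 ≤ rayCoord n r (x i)) (hj : 0 ≤ rayCoord n r (x j)) : i = j := by
  obtain ⟨p, hp⟩ := h.exists_common
  exact eq_of_nonneg_of_forall_notMem (continuous_rayCoord n r)
    (rayCoord_injective_of_nonneg hn hr) h.isPreconnected hp h.mem h.notMem (by decide) hi hj

theorem exists_forall_zero_mem (h : IsWeakTriod T x) (hn : n ≠ 0) :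
    ∃ l, ∀ i, i ≠ l → armPt n 0 0 ∈ T i := by
  by_contra! hcon
  obtain ⟨i, -, hi⟩ := hcon 0
  obtain ⟨j, hji, hj⟩ := hcon i
  obtain ⟨p, hp⟩ := h.exists_common
  obtain ⟨r, t, hr, h0, h1, rfl⟩ := exists_eq_armPt hn p
  have hpos : 0 ≤ rayCoord n r (armPt n r t) := by rwa [rayCoord_armPt_self h0 h1]
  exact hji (h.eq_of_rayCoord_nonneg hn hr
    (rayCoord_nonneg_of_zero_notMem hn hr (h.isPreconnected j) hj (hp j) (h.mem j) hpos)
    (rayCoord_nonneg_of_zero_notMem hn hr (h.isPreconnected i) hi (hp i) (h.mem i) hpos))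

theorem exists_forall_mid_mem (h : IsWeakTriod T x) (hn : 3 ≤ n)
    (h' : IsWeakTriod (fun i => fS n '' T i) fun i => fS n (x i)) :
    ∃ l, ∀ i, i ≠ l → armPt n 0 0 ∈ fS n '' T i ∧ armPt n (n - 2) (1 / 2) ∈ fS n '' T i := by
  have hn0 : n ≠ 0 := by omega
  have hn2 : n - 2 < n := by omega
  obtain ⟨l, hl⟩ := h.exists_forall_zero_mem hn0
  have hzero : ∀ i, i ≠ l → armPt n 0 0 ∈ fS n '' T i := fun i hi => ⟨_, hl i hi, fS_zero hn0⟩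
  have hhalf : ∀ i, i ≠ l → armPt n (n - 2) (1 / 2) ∈ fS n '' T i ∨
      ∀ z ∈ T i, ∃ u, 0 ≤ u ∧ u ≤ 1 / 2 ∧ fS n z = armPt n (n - 2) u := by
    intro i hi
    by_contra! hcon
    obtain ⟨hmid, z, hz, hfz⟩ := hcon
    obtain ⟨r, t, hr, h0, h1, rfl⟩ := exists_eq_armPt hn0 z
    obtain ⟨τ, hτ0, hτ1, hτ, hτt⟩ := exists_fS_armPt_eq_mid hn hr
    rcases le_total t τ with htτ | htτ
    · obtain ⟨u, hu0, hu1, hu⟩ := hτt t h0 htτ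
      exact hfz u hu0 hu1 hu
    · exact hmid ⟨_, armPt_mem_of_isPreconnected hn0 hr (h.isPreconnected i) (hl i hi) hτ0 htτ h1
        hz, hτ⟩
  refine ⟨l, fun i hi => ⟨hzero i hi, (hhalf i hi).resolve_right fun hin => ?_⟩⟩
  obtain ⟨j, hji, hjl⟩ : ∃ j, j ≠ i ∧ j ≠ l := Fin.exists_ne_and_ne_of_two_lt i l (by decide)
  obtain ⟨u, hu0, hu1, hu⟩ := hin _ (h.mem i)
  rcases hhalf j hjl with hj | hj
  · refine h'.notMem i j hji.symm ?_
    rw [hu]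
    exact armPt_mem_of_isPreconnected hn0 hn2 (h'.isPreconnected j) (hzero j hjl) hu0 hu1
      (by norm_num) hj
  · obtain ⟨v, hv0, hv1, hv⟩ := hj _ (h.mem j)
    refine hji (h'.eq_of_rayCoord_nonneg hn0 hn2 ?_ ?_)
    · rwa [hv, rayCoord_armPt_self hv0 (by linarith)]
    · rwa [hu, rayCoord_armPt_self hu0 (by linarith)]

/-- In a weak triod, two of the three sets cannot both contain all arms but two. -/
theorem not_forall_arm_subset (h : IsWeakTriod T x) (hn : 3 ≤ n) :
    ¬ ∃ l, ∀ i, i ≠ l → ∀ r < n - 2, ∀ t, 0 ≤ t → t ≤ 1 → armPt n r t ∈ T i := by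
  have hn0 : n ≠ 0 := by omega
  rintro ⟨l, hl⟩
  have houter : ∀ i, 0 ≤ rayCoord n (n - 2) (x i) ∨ 0 ≤ rayCoord n (n - 1) (x i) := by
    intro i
    obtain ⟨j, hji, hjl⟩ : ∃ j, j ≠ i ∧ j ≠ l := Fin.exists_ne_and_ne_of_two_lt i l (by decide)
    obtain ⟨r, t, hr, h0, h1, hx⟩ := exists_eq_armPt hn0 (x i)
    have hrn : ¬ r < n - 2 := fun hrn => h.notMem i j hji.symm (hx ▸ hl j hjl r hrn t h0 h1)
    rcases (by omega : r = n - 2 ∨ r = n - 1) with rfl | rfl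
    · left
      rwa [hx, rayCoord_armPt_self h0 h1]
    · right
      rwa [hx, rayCoord_armPt_self h0 h1]
  have hne : ∀ i j, i ≠ j → 0 ≤ rayCoord n (n - 2) (x i) → 0 ≤ rayCoord n (n - 1) (x j) :=
    fun i j hij hi => (houter j).resolve_left fun hj =>
      hij (h.eq_of_rayCoord_nonneg hn0 (by omega) hi hj)
  have hne' : ∀ i j, i ≠ j → 0 ≤ rayCoord n (n - 1) (x i) → 0 ≤ rayCoord n (n - 2) (x j) :=
    fun i j hij hi => (houter j).resolve_right fun hj =>
      hij (h.eq_of_rayCoord_nonneg hn0 (by omega) hi hj)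
  rcases houter 0 with h0 | h0
  · exact absurd (h.eq_of_rayCoord_nonneg hn0 (by omega) (hne 0 1 (by decide) h0)
      (hne 0 2 (by decide) h0)) (by decide)
  · exact absurd (h.eq_of_rayCoord_nonneg hn0 (by omega) (hne' 0 1 (by decide) h0)
      (hne' 0 2 (by decide) h0)) (by decide)

end IsWeakTriod

/-- No weak triod in the simple-`n`-od is the image of weak triods under all iterates of the
bonding map. -/
theorem not_forall_isWeakTriod {n : ℕ} (hn : 3 ≤ n) {T : ℕ → Fin 3 → Set (Sspace n)}
    {x : ℕ → Fin 3 → Sspace n} (hT : ∀ k i, fS n '' T (k + 1) i = T k i)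
    (hx : ∀ k i, fS n (x (k + 1) i) = x k i) (N : ℕ)
    (h : ∀ k, N ≤ k → IsWeakTriod (T k) (x k)) : False := by
  have hn0 : n ≠ 0 := by omega
  obtain ⟨l, hl⟩ := (h (N + 3) (by omega)).exists_forall_mid_mem hn (by
    simp only [hT, hx]
    exact h (N + 2) (by omega))
  refine (h N le_rfl).not_forall_arm_subset hn ⟨l, fun i hi r hr t h0 h1 => ?_⟩
  obtain ⟨hz2, hm2⟩ := hl i hi
  rw [hT] at hz2 hm2
  have hz1 : armPt n 0 0 ∈ T (N + 1) i := hT (N + 1) i ▸ ⟨_, hz2, fS_zero hn0⟩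
  have hm1 : armPt n (n - 1) (1 / 2) ∈ T (N + 1) i := hT (N + 1) i ▸ ⟨_, hm2, fS_mid hn⟩
  obtain ⟨s, hs0, hs1, hs⟩ := exists_fS_armPt_eq_tip hn hr
  have hs' : armPt n (n - 1) s ∈ T (N + 1) i :=
    armPt_mem_of_isPreconnected hn0 (by omega) ((h (N + 1) (by omega)).isPreconnected i) hz1 hs0
      hs1 (by norm_num) hm1
  exact armPt_mem_of_isPreconnected hn0 (by omega) ((h N le_rfl).isPreconnected i)
    (hT N i ▸ ⟨_, hz1, fS_zero hn0⟩) h0 h1 le_rfl (hT N i ▸ ⟨_, hs', hs⟩)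

/-- For `n ≥ 3`, the inverse limit `nK` of the bonding map `φ = nφ`
is atriodic. -/
theorem statement9 (n : ℕ) (hn : 3 ≤ n) : AtriodicSpace (nK n) := by
  rintro C hC hCc ⟨M, A, B, D, hM, hMc, hMC, ⟨a, ha⟩, ⟨b, hb⟩, ⟨d, hd⟩, hCM, hAB, hAD, hBD⟩
  have leg : ∀ E R : Set (nK n), C \ M = E ∪ R → MutuallySeparated E R → ∀ z ∈ E,
      IsPreconnected (M ∪ E) ∧ ∃ N, ∀ k, N ≤ k → ∀ w ∈ M ∪ R, w.1 k ≠ z.1 k := by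
    refine fun E R h hER z hz => ⟨isPreconnected_union_of_separated hCc.isPreconnected
      hMc.isPreconnected hMC h hER, exists_forall_coord_notMem_image
      (isCompact_union_of_separated hC hM hMC h hER) ?_⟩
    rintro (hzM | hzR)
    · exact (h.symm.subset (Or.inl hz)).2 hzM
    · have : z ∈ E ∩ closure R := ⟨hz, subset_closure hzR⟩
      simp [hER.1] at this
  obtain ⟨hcA, NA, hNA⟩ := leg A (B ∪ D) (by rw [hCM, Set.union_assoc])
    (hAB.union_right hAD) a ha
  obtain ⟨hcB, NB, hNB⟩ := leg B (A ∪ D) (by rw [hCM, ← Set.union_assoc, Set.union_comm B A])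
    (hAB.symm.union_right hBD) b hb
  obtain ⟨hcD, ND, hND⟩ := leg D (A ∪ B) (by rw [hCM, Set.union_comm D])
    (hAD.symm.union_right hBD.symm) d hd
  have hcont : ∀ k, Continuous fun w : nK n => w.1 k :=
    fun k => (continuous_apply k).comp continuous_subtype_val
  obtain ⟨m, hm⟩ := hMc.nonempty
  refine not_forall_isWeakTriod hn
    (T := fun k i => (fun w : nK n => w.1 k) '' (M ∪ ![A, B, D] i))
    (x := fun k i => (![a, b, d] i).1 k) (fun k i => ?_) (fun k i => (![a, b, d] i).2 k)
    (NA + NB + ND) fun k hk => ⟨fun i => ?_, ⟨m.1 k, fun i => ⟨m, Or.inl hm, rfl⟩⟩, fun i => ?_, ?_⟩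
  · rw [Set.image_image]
    exact Set.image_congr fun w _ => w.2 k
  · refine IsPreconnected.image ?_ _ (hcont k).continuousOn
    fin_cases i
    exacts [hcA, hcB, hcD]
  · refine ⟨_, Or.inr ?_, rfl⟩
    fin_cases i
    exacts [ha, hb, hd]
  · rintro i j hij ⟨w, hw, hwk⟩
    have hA := hNA k (by omega) w
    have hB := hNB k (by omega) w
    have hD := hND k (by omega) w
    fin_cases i <;> fin_cases j <;> simp at hij hw hwk hA hB hD <;> tauto
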